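/- Let γ < 0 and define, for f : ℝ → ℂ continuous and differentiable with f, its derivative f', and x ↦ x·f(x) square-integrable on ℝ (call such f admissible), the quadratic form B₁^γ(f) = ∫_ℝ |f'(x)|² dx + ∫_ℝ ((|x| + γ/2)² - 3)·|f(x)|² dx - γ·|f(0)|². Then: (a) there exist admissible functions f₁, f₂, linearly independent over ℂ, such that B₁^γ(c₁f₁ + c₂f₂) < 0 for every (c₁, c₂) ∈ ℂ² with (c₁, c₂) ≠ (0,0); and (b) for any admissible functions f₁, f₂, f₃ that are linearly independent over ℂ, there exists (c₁, c₂, c₃) ∈ ℂ³ with (c₁, c₂, c₃) ≠ (0,0,0) such that B₁^γ(c₁f₁ + c₂f₂ + c₃f₃) ≥ 0. -/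

import Mathlib

open MeasureTheory Filter Set Topology

/-- Membership in the weighted space `W̃`: `f` is continuous and differentiable with
`f`, `f'`, and `x ↦ x·f(x)` square-integrable on `ℝ`. -/
def Admissible (f : ℝ → ℂ) : Prop :=
  Continuous f ∧ Differentiable ℝ f ∧
  Integrable (fun x => ‖f x‖ ^ 2) ∧
  Integrable (fun x => ‖deriv f x‖ ^ 2) ∧
  Integrable (fun x => ‖x • f x‖ ^ 2)

/-- The quadratic form of the linearized operator `L₁^γ = -d²/dx² + (|x|+γ/2)² - 3`
with δ-interaction of strength `γ`. -/
noncomputable def B1 (γ : ℝ) (f : ℝ → ℂ) : ℝ :=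
  (∫ x : ℝ, ‖deriv f x‖ ^ 2) + (∫ x : ℝ, ((|x| + γ / 2) ^ 2 - 3) * ‖f x‖ ^ 2)
    - γ * ‖f 0‖ ^ 2

/-- One-sided fundamental theorem of calculus on a half-line, for a primitive bounded below by the
negative of an integrable function. -/
lemma neg_le_integral_Ioi_of_hasDerivAt_of_le {F F' G K : ℝ → ℝ} {s : ℝ}
    (hF : ContinuousOn F (Ici s)) (hd : ∀ x ∈ Ioi s, HasDerivAt F (F' x) x)
    (hle : ∀ x ∈ Ioi s, F' x ≤ G x) (hG : Integrable G) (hK : Integrable K)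
    (hFK : ∀ x ∈ Ioi s, -K x ≤ F x) : -F s ≤ ∫ x in Ioi s, G x := by
  by_contra! hlt
  obtain ⟨ε, hε, hεlt⟩ : ∃ ε > 0, ∫ x in Ioi s, G x < -F s - ε :=
    ⟨(-F s - ∫ x in Ioi s, G x) / 2, by linarith, by linarith⟩
  have htend := intervalIntegral_tendsto_integral_Ioi s hG.integrableOn tendsto_id
  obtain ⟨N, hN⟩ := eventually_atTop.1
    ((htend.eventually (eventually_lt_nhds hεlt)).and (eventually_gt_atTop s))
  have hKε : ∀ R ∈ Ioi N, ε ≤ K R := by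
    intro R hR
    obtain ⟨hR₁, hR₂⟩ := hN R hR.le
    have h := intervalIntegral.sub_le_integral_of_hasDeriv_right_of_le hR₂.le
      (hF.mono Icc_subset_Ici_self) (fun x hx => (hd x hx.1).hasDerivWithinAt)
      hG.integrableOn (fun x hx => hle x hx.1)
    have := hFK R hR₂
    simp only [id] at hR₁
    linarith
  have hconst : IntegrableOn (fun _ : ℝ => ε) (Ioi N) := by
    refine Integrable.mono' hK.integrableOn aestronglyMeasurable_const ?_
    filter_upwards [ae_restrict_mem measurableSet_Ioi] with x hx
    rw [Real.norm_of_nonneg hε.le]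
    exact hKε x hx
  simp [integrableOn_const_iff, hε.ne'] at hconst

/-- The pointwise energy density of the form `B1 (-2 * a)`, without the point interaction. -/
noncomputable def energyDensity (a : ℝ) (f : ℝ → ℂ) (x : ℝ) : ℝ :=
  ‖deriv f x‖ ^ 2 + ((|x| - a) ^ 2 - 3) * ‖f x‖ ^ 2

namespace Admissible

variable {f g : ℝ → ℂ}

lemma add (hf : Admissible f) (hg : Admissible g) : Admissible (f + g) := by
  obtain ⟨hf₀, hf₁, hf₂, hf₃, hf₄⟩ := hf
  obtain ⟨hg₀, hg₁, hg₂, hg₃, hg₄⟩ := hg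
  have key : ∀ {u v : ℝ → ℂ}, Measurable u → Measurable v → Integrable (fun x => ‖u x‖ ^ 2) →
      Integrable (fun x => ‖v x‖ ^ 2) → Integrable (fun x => ‖u x + v x‖ ^ 2) := by
    intro u v hu hv hu₂ hv₂
    refine ((hu₂.add hv₂).const_mul 2).mono' (by fun_prop) (ae_of_all _ fun x => ?_)
    rw [Real.norm_of_nonneg (by positivity)]
    have := parallelogram_law_with_norm ℝ (u x) (v x)
    simp only [Pi.add_apply]
    nlinarith [sq_nonneg ‖u x - v x‖]
  refine ⟨hf₀.add hg₀, hf₁.add hg₁, key hf₀.measurable hg₀.measurable hf₂ hg₂, ?_, ?_⟩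
  · simp_rw [fun x => deriv_add (hf₁ x) (hg₁ x)]
    exact key (measurable_deriv f) (measurable_deriv g) hf₃ hg₃
  · simp only [Pi.add_apply, smul_add]
    have := hf₀.measurable
    have := hg₀.measurable
    exact key (by fun_prop) (by fun_prop) hf₄ hg₄

lemma const_smul (hf : Admissible f) (c : ℂ) : Admissible (c • f) := by
  obtain ⟨hf₀, hf₁, hf₂, hf₃, hf₄⟩ := hf
  refine ⟨hf₀.const_smul c, hf₁.const_smul c, ?_, ?_, ?_⟩
  · simpa [mul_pow] using hf₂.const_mul (‖c‖ ^ 2)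
  · simp_rw [fun x => deriv_const_smul c (hf₁ x), norm_smul, mul_pow]
    exact hf₃.const_mul _
  · simp only [Pi.smul_apply, smul_comm _ c, norm_smul c, mul_pow]
    exact hf₄.const_mul _

lemma comp_neg (hf : Admissible f) : Admissible (fun x => f (-x)) := by
  obtain ⟨hf₀, hf₁, hf₂, hf₃, hf₄⟩ := hf
  refine ⟨hf₀.comp continuous_neg, hf₁.comp differentiable_neg, hf₂.comp_neg, ?_, ?_⟩
  · simpa [deriv_comp_neg] using hf₃.comp_neg
  · simpa using hf₄.comp_neg

lemma integrable_one_add_sq_mul (hf : Admissible f) :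
    Integrable (fun x => (1 + x ^ 2) * ‖f x‖ ^ 2) := by
  obtain ⟨-, -, hf₂, -, hf₄⟩ := hf
  refine (hf₂.add hf₄).congr (ae_of_all _ fun x => ?_)
  simp only [Pi.add_apply, norm_smul, mul_pow, Real.norm_eq_abs, sq_abs]
  ring

lemma integrable_abs_mul (hf : Admissible f) : Integrable (fun x => |x| * ‖f x‖ ^ 2) := by
  have hc : Continuous f := hf.1
  refine hf.integrable_one_add_sq_mul.mono' (by fun_prop) (ae_of_all _ fun x => ?_)
  rw [Real.norm_of_nonneg (by positivity)]
  gcongr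
  nlinarith [sq_abs x, sq_nonneg (|x| - 1)]

lemma integrable_potential (hf : Admissible f) (a : ℝ) :
    Integrable (fun x => ((|x| - a) ^ 2 - 3) * ‖f x‖ ^ 2) := by
  refine ((hf.integrable_one_add_sq_mul.sub (hf.integrable_abs_mul.const_mul (2 * a))).add
    (hf.2.2.1.const_mul (a ^ 2 - 4))).congr (ae_of_all _ fun x => ?_)
  simp only [Pi.add_apply, Pi.sub_apply, ← sq_abs x]
  ring

lemma integrable_energyDensity (hf : Admissible f) (a : ℝ) : Integrable (energyDensity a f) :=
  hf.2.2.2.1.add (hf.integrable_potential a)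

lemma B1_eq (hf : Admissible f) (a : ℝ) :
    B1 (-2 * a) f = (∫ x, energyDensity a f x) + 2 * a * ‖f 0‖ ^ 2 := by
  have h := integral_add hf.2.2.2.1 (hf.integrable_potential a)
  simp only [B1, energyDensity, h, show -2 * a / 2 = -a by ring, ← sub_eq_add_neg]
  ring

lemma energyDensity_comp_neg (a : ℝ) (f : ℝ → ℂ) (x : ℝ) :
    energyDensity a (fun y => f (-y)) x = energyDensity a f (-x) := by
  simp [energyDensity, deriv_comp_neg]

lemma integral_energyDensity (hf : Admissible f) (a : ℝ) :
    ∫ x, energyDensity a f x = (∫ x in Ioi 0, energyDensity a f x) +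
      ∫ x in Ioi 0, energyDensity a (fun y => f (-y)) x := by
  have hi := hf.integrable_energyDensity a
  simp_rw [energyDensity_comp_neg]
  rw [integral_comp_neg_Ioi, neg_zero, add_comm,
    intervalIntegral.integral_Iic_add_Ioi hi.integrableOn hi.integrableOn]

lemma B1_comp_neg (hf : Admissible f) (a : ℝ) :
    B1 (-2 * a) (fun x => f (-x)) = B1 (-2 * a) f := by
  rw [hf.B1_eq, hf.comp_neg.B1_eq]
  simp_rw [energyDensity_comp_neg]
  rw [integral_neg_eq_self (energyDensity a f), neg_zero]

lemma B1_const_smul (hf : Admissible f) (a : ℝ) (c : ℂ) :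
    B1 (-2 * a) (c • f) = ‖c‖ ^ 2 * B1 (-2 * a) f := by
  have h : energyDensity a (c • f) = fun x => ‖c‖ ^ 2 * energyDensity a f x := by
    funext x
    simp only [energyDensity, deriv_const_smul c (hf.2.1 x), Pi.smul_apply, norm_smul]
    ring
  rw [(hf.const_smul c).B1_eq, hf.B1_eq, h, integral_const_mul, Pi.smul_apply, norm_smul]
  ring

lemma B1_parallelogram (hf : Admissible f) (hg : Admissible g) (a : ℝ) :
    B1 (-2 * a) (f + g) + B1 (-2 * a) (f - g) = 2 * (B1 (-2 * a) f + B1 (-2 * a) g) := by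
  have hsub : Admissible (f - g) := by
    simpa [sub_eq_add_neg] using hf.add (hg.const_smul (-1))
  have h : ∀ x, energyDensity a (f + g) x + energyDensity a (f - g) x =
      2 * (energyDensity a f x + energyDensity a g x) := by
    intro x
    simp only [energyDensity, deriv_add (hf.2.1 x) (hg.2.1 x), deriv_sub (hf.2.1 x) (hg.2.1 x),
      Pi.add_apply, Pi.sub_apply]
    linear_combination parallelogram_law_with_norm ℝ (deriv f x) (deriv g x) +
      ((|x| - a) ^ 2 - 3) * parallelogram_law_with_norm ℝ (f x) (g x)
  have hint := integral_add ((hf.add hg).integrable_energyDensity a)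
    (hsub.integrable_energyDensity a)
  simp_rw [h] at hint
  rw [integral_const_mul, integral_add (hf.integrable_energyDensity a)
    (hg.integrable_energyDensity a)] at hint
  rw [(hf.add hg).B1_eq, hsub.B1_eq, hf.B1_eq, hg.B1_eq, Pi.add_apply, Pi.sub_apply]
  linear_combination -hint + 2 * a * parallelogram_law_with_norm ℝ (f 0) (g 0)

/-- The form is diagonal on the sum of an even and an odd function. -/
lemma B1_even_add_odd (hf : Admissible f) (hg : Admissible g) (hfe : ∀ x, f (-x) = f x)
    (hgo : ∀ x, g (-x) = -g x) (a : ℝ) :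
    B1 (-2 * a) (f + g) = B1 (-2 * a) f + B1 (-2 * a) g := by
  have h := (hf.add hg).B1_comp_neg a
  have hneg : (fun x => (f + g) (-x)) = f - g := by
    funext x
    simp [hfe, hgo, sub_eq_add_neg]
  rw [hneg] at h
  linarith [hf.B1_parallelogram hg a]

/-- A Riccati substitution with the eigenfunction `(x - a) * exp (-(x - a) ^ 2 / 2)` bounds the
half-line energy of a function vanishing at `a`. -/
lemma le_integral_Ioi_energyDensity (hf : Admissible f) {a : ℝ} (ha : 0 < a) (hfa : f a = 0) :
    (1 / a - a) * ‖f 0‖ ^ 2 ≤ ∫ x in Ioi 0, energyDensity a f x := by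
  have hi := hf.integrable_energyDensity a
  set N : ℝ → ℝ := fun x => ‖f x‖ ^ 2 with hN
  set F : ℝ → ℝ := fun x => ((x - a)⁻¹ - (x - a)) * N x with hFdef
  set F' : ℝ → ℝ := fun x => (-1 / (x - a) ^ 2 - 1) * N x +
    ((x - a)⁻¹ - (x - a)) * (2 * inner ℝ (f x) (deriv f x)) with hF'def
  have hNd : ∀ x, HasDerivAt N (2 * inner ℝ (f x) (deriv f x)) x := fun x =>
    (hf.2.1 x).hasDerivAt.norm_sq
  have hNc : Continuous N := by
    have := hf.1
    fun_prop
  have hNa : N a = 0 := by simp [hN, hfa]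
  have hFa : F a = 0 := by simp [hFdef, hNa]
  have hFd : ∀ x, x ≠ a → HasDerivAt F (F' x) x := by
    intro x hx
    have hsub : HasDerivAt (fun y : ℝ => y - a) 1 x := (hasDerivAt_id x).sub_const a
    exact ((hsub.inv (sub_ne_zero.2 hx)).sub hsub).mul (hNd x)
  have hFc : Continuous F := by
    rw [continuous_iff_continuousAt]
    intro x
    rcases ne_or_eq x a with hx | rfl
    · exact (hFd x hx).continuousAt
    · have hs := hasDerivAt_iff_tendsto_slope.1 (hNd x)
      rw [hfa, inner_zero_left, mul_zero] at hs
      have hm : Tendsto (fun y => (y - x) * N y) (𝓝[≠] x) (𝓝 0) := by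
        have : Continuous fun y => (y - x) * N y := by fun_prop
        simpa using (this.tendsto x).mono_left nhdsWithin_le_nhds
      rw [← continuousWithinAt_compl_self, ContinuousWithinAt, hFa]
      simpa [hFdef, slope_fun_def, hNa, sub_mul] using hs.sub hm
  have hFle : ∀ x, 0 < x → x ≠ a → F' x ≤ energyDensity a f x := by
    intro x hx hxa
    have hxa' := sub_ne_zero.2 hxa
    have h := norm_sub_sq_real (deriv f x) (((x - a)⁻¹ - (x - a)) • f x)
    rw [inner_smul_right, real_inner_comm, norm_smul, mul_pow, Real.norm_eq_abs, sq_abs] at h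
    have hw : ((x - a)⁻¹ - (x - a)) ^ 2 + (-1 / (x - a) ^ 2 - 1) = (x - a) ^ 2 - 3 := by
      field_simp
      ring
    simp only [hF'def, hN, energyDensity, abs_of_pos hx, ← hw]
    nlinarith [sq_nonneg ‖deriv f x - ((x - a)⁻¹ - (x - a)) • f x‖]
  have h₁ : F a - F 0 ≤ ∫ x in (0 : ℝ)..a, energyDensity a f x :=
    intervalIntegral.sub_le_integral_of_hasDeriv_right_of_le ha.le hFc.continuousOn
      (fun x hx => (hFd x hx.2.ne).hasDerivWithinAt) hi.integrableOn
      (fun x hx => hFle x hx.1 hx.2.ne)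
  have h₂ : -F a ≤ ∫ x in Ioi a, energyDensity a f x := by
    refine neg_le_integral_Ioi_of_hasDerivAt_of_le hFc.continuousOn
      (fun x hx => hFd x (ne_of_gt hx)) (fun x hx => hFle x (ha.trans hx) (ne_of_gt hx)) hi
      hf.integrable_abs_mul fun x hx => ?_
    have hx0 : a < x := hx
    have hinv : 0 < (x - a)⁻¹ := inv_pos.2 (sub_pos.2 hx0)
    simp only [hFdef, hN, ← neg_mul, abs_of_pos (ha.trans hx0)]
    gcongr
    linarith
  have h₃ := intervalIntegral.integral_interval_add_Ioi (a := 0) (b := a)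
    hi.integrableOn hi.integrableOn
  have hF0 : F 0 = -((1 / a - a) * ‖f 0‖ ^ 2) := by
    simp only [hFdef, hN, zero_sub, inv_neg]
    ring
  rw [← h₃]
  linarith

/-- The form is nonnegative on functions vanishing at `a` and `-a`. -/
lemma B1_nonneg (hf : Admissible f) {a : ℝ} (ha : 0 < a) (hfa : f a = 0) (hfa' : f (-a) = 0) :
    0 ≤ B1 (-2 * a) f := by
  have h₁ := hf.le_integral_Ioi_energyDensity ha hfa
  have h₂ := hf.comp_neg.le_integral_Ioi_energyDensity ha hfa'
  rw [hf.B1_eq, hf.integral_energyDensity]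
  rw [neg_zero] at h₂
  have : 0 ≤ 1 / a * ‖f 0‖ ^ 2 := by positivity
  linarith

end Admissible

lemma integrable_exp_neg_sq_div_two : Integrable fun x : ℝ => Real.exp (-x ^ 2 / 2) := by
  refine (integrable_exp_neg_mul_sq (b := 1 / 2) (by norm_num)).congr (ae_of_all _ fun x => ?_)
  ring_nf

lemma integrable_sq_mul_exp_neg_sq_div_two :
    Integrable fun x : ℝ => x ^ 2 * Real.exp (-x ^ 2 / 2) := by
  refine (integrable_rpow_mul_exp_neg_mul_sq (b := 1 / 2) (by norm_num) (s := 2)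
    (by norm_num)).congr (ae_of_all _ fun x => ?_)
  simp only [Real.rpow_two]
  ring_nf

/-- Smooth real functions with Gaussian decay are admissible. -/
lemma admissible_ofReal {g g' : ℝ → ℝ} {C : ℝ} (hd : ∀ x, HasDerivAt g (g' x) x)
    (hg : ∀ x, |g x| ≤ C * Real.exp (-x ^ 2 / 4))
    (hg' : ∀ x, |g' x| ≤ C * (1 + |x|) * Real.exp (-x ^ 2 / 4)) :
    Admissible fun x => (g x : ℂ) := by
  have hd' : ∀ x, HasDerivAt (fun x => (g x : ℂ)) (g' x : ℂ) x := fun x => (hd x).ofReal_comp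
  have hC : 0 ≤ C := by simpa using (abs_nonneg _).trans (hg 0)
  have key : ∀ u : ℝ → ℂ, Measurable u →
      (∀ x, ‖u x‖ ≤ C * (1 + |x|) * Real.exp (-x ^ 2 / 4)) → Integrable fun x => ‖u x‖ ^ 2 := by
    intro u hu hle
    refine ((integrable_exp_neg_sq_div_two.add
      integrable_sq_mul_exp_neg_sq_div_two).const_mul (2 * C ^ 2)).mono' (by fun_prop)
      (ae_of_all _ fun x => ?_)
    have hexp : Real.exp (-x ^ 2 / 4) ^ 2 = Real.exp (-x ^ 2 / 2) := by
      rw [← Real.exp_nat_mul]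
      congr 1
      push_cast
      ring
    have hx : (1 + |x|) ^ 2 ≤ 2 * (1 + x ^ 2) := by
      nlinarith [sq_abs x, sq_nonneg (|x| - 1)]
    rw [Real.norm_of_nonneg (by positivity)]
    calc ‖u x‖ ^ 2 ≤ (C * (1 + |x|) * Real.exp (-x ^ 2 / 4)) ^ 2 := by gcongr; exact hle x
      _ = C ^ 2 * (1 + |x|) ^ 2 * Real.exp (-x ^ 2 / 2) := by rw [mul_pow, mul_pow, hexp]
      _ ≤ C ^ 2 * (2 * (1 + x ^ 2)) * Real.exp (-x ^ 2 / 2) := by gcongr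
      _ = 2 * C ^ 2 * (Real.exp (-x ^ 2 / 2) + x ^ 2 * Real.exp (-x ^ 2 / 2)) := by ring
  have hcont : Continuous fun x => (g x : ℂ) :=
    continuous_iff_continuousAt.2 fun x => (hd' x).continuousAt
  have hmeas := hcont.measurable
  refine ⟨hcont, fun x => (hd' x).differentiableAt, key _ hmeas fun x => ?_,
    key _ (measurable_deriv _) fun x => ?_, key _ (by fun_prop) fun x => ?_⟩
  · rw [Complex.norm_real, Real.norm_eq_abs]
    refine (hg x).trans ?_
    gcongr
    exact le_mul_of_one_le_right hC (by linarith [abs_nonneg x])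
  · rw [(hd' x).deriv, Complex.norm_real, Real.norm_eq_abs]
    exact hg' x
  · rw [norm_smul, Complex.norm_real, Real.norm_eq_abs, Real.norm_eq_abs]
    calc |x| * |g x| ≤ |x| * (C * Real.exp (-x ^ 2 / 4)) := by gcongr; exact hg x
      _ ≤ (1 + |x|) * (C * Real.exp (-x ^ 2 / 4)) := by gcongr; linarith
      _ = _ := by ring

lemma Real.cosh_le_exp_abs (x : ℝ) : Real.cosh x ≤ Real.exp |x| := by
  rw [← Real.cosh_abs, ← Real.cosh_add_sinh]
  linarith [Real.sinh_nonneg_iff.2 (abs_nonneg x)]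

lemma Real.abs_sinh_le_cosh (x : ℝ) : |Real.sinh x| ≤ Real.cosh x := by
  rw [Real.abs_sinh, ← Real.cosh_abs x]
  exact (Real.sinh_lt_cosh _).le

lemma exp_mul_cosh_le {a : ℝ} (ha : 0 < a) (x : ℝ) :
    Real.exp (-x ^ 2 / 2) * Real.cosh (a * x) ≤ Real.exp (a ^ 2) * Real.exp (-x ^ 2 / 4) := by
  calc _ ≤ Real.exp (-x ^ 2 / 2) * Real.exp |a * x| := by
        gcongr
        exact Real.cosh_le_exp_abs _
    _ ≤ _ := by
        rw [← Real.exp_add, ← Real.exp_add, abs_mul, abs_of_pos ha, Real.exp_le_exp]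
        nlinarith [sq_abs x, sq_nonneg (|x| / 2 - a)]

lemma abs_exp_mul_sub_le {a s c x : ℝ} (ha : 0 < a) (hs : |s| ≤ Real.cosh (a * x))
    (hc : |c| ≤ Real.cosh (a * x)) :
    |Real.exp (-x ^ 2 / 2) * (a * s - x * c)| ≤
      Real.exp (a ^ 2) * (1 + a) * (1 + |x|) * Real.exp (-x ^ 2 / 4) := by
  have hx := abs_nonneg x
  rw [abs_mul, Real.abs_exp]
  calc _ ≤ Real.exp (-x ^ 2 / 2) * (a * Real.cosh (a * x) + |x| * Real.cosh (a * x)) := by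
        gcongr
        refine (abs_sub _ _).trans ?_
        rw [abs_mul, abs_mul, abs_of_pos ha]
        gcongr
    _ = (a + |x|) * (Real.exp (-x ^ 2 / 2) * Real.cosh (a * x)) := by ring
    _ ≤ (a + |x|) * (Real.exp (a ^ 2) * Real.exp (-x ^ 2 / 4)) := by
        exact mul_le_mul_of_nonneg_left (exp_mul_cosh_le ha x) (by positivity)
    _ ≤ ((1 + a) * (1 + |x|)) * (Real.exp (a ^ 2) * Real.exp (-x ^ 2 / 4)) := by
        gcongr
        nlinarith
    _ = _ := by ring

lemma hasDerivAt_exp_neg_sq_div_two (x : ℝ) :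
    HasDerivAt (fun x => Real.exp (-x ^ 2 / 2)) (-x * Real.exp (-x ^ 2 / 2)) x := by
  convert (((hasDerivAt_pow 2 x).fun_neg).div_const 2).exp using 1
  push_cast
  ring

/-- The even trial function. -/
noncomputable def evenTrial (a x : ℝ) : ℝ := Real.exp (-x ^ 2 / 2) * Real.cosh (a * x)

/-- The odd trial function. -/
noncomputable def oddTrial (a x : ℝ) : ℝ := Real.exp (-x ^ 2 / 2) * Real.sinh (a * x)

lemma hasDerivAt_evenTrial (a x : ℝ) : HasDerivAt (evenTrial a)
    (Real.exp (-x ^ 2 / 2) * (a * Real.sinh (a * x) - x * Real.cosh (a * x))) x := by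
  refine ((hasDerivAt_exp_neg_sq_div_two x).fun_mul
    ((hasDerivAt_id' x).const_mul a).cosh).congr_deriv ?_
  ring

lemma hasDerivAt_oddTrial (a x : ℝ) : HasDerivAt (oddTrial a)
    (Real.exp (-x ^ 2 / 2) * (a * Real.cosh (a * x) - x * Real.sinh (a * x))) x := by
  refine ((hasDerivAt_exp_neg_sq_div_two x).fun_mul
    ((hasDerivAt_id' x).const_mul a).sinh).congr_deriv ?_
  ring

lemma admissible_evenTrial {a : ℝ} (ha : 0 < a) : Admissible fun x => (evenTrial a x : ℂ) := by
  refine admissible_ofReal (hasDerivAt_evenTrial a) (C := Real.exp (a ^ 2) * (1 + a))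
    (fun x => ?_) fun x => abs_exp_mul_sub_le ha (Real.abs_sinh_le_cosh _) (abs_of_pos (Real.cosh_pos _)).le
  rw [evenTrial, abs_mul, Real.abs_exp, abs_of_pos (Real.cosh_pos _)]
  refine (exp_mul_cosh_le ha x).trans ?_
  gcongr
  exact le_mul_of_one_le_right (by positivity) (by linarith)

lemma admissible_oddTrial {a : ℝ} (ha : 0 < a) : Admissible fun x => (oddTrial a x : ℂ) := by
  refine admissible_ofReal (hasDerivAt_oddTrial a) (C := Real.exp (a ^ 2) * (1 + a))
    (fun x => ?_) fun x => abs_exp_mul_sub_le ha (abs_of_pos (Real.cosh_pos _)).le (Real.abs_sinh_le_cosh _)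
  rw [oddTrial, abs_mul, Real.abs_exp]
  refine (mul_le_mul_of_nonneg_left (Real.abs_sinh_le_cosh _) (by positivity)).trans ?_
  refine (exp_mul_cosh_le ha x).trans ?_
  gcongr
  exact le_mul_of_one_le_right (by positivity) (by linarith)

/-- Upper bound for the half-line energy of a real function, obtained by completing the square
with the ground state `exp (-(x - a) ^ 2 / 2)`. -/
lemma integral_Ioi_energyDensity_le {g g' Q Q' K : ℝ → ℝ} {a : ℝ}
    (hg : Admissible fun x => (g x : ℂ)) (hd : ∀ x, HasDerivAt g (g' x) x)
    (hQ : ∀ x, HasDerivAt Q (Q' x) x) (hK : Integrable K) (hQK : ∀ x, 0 < x → Q x ≤ K x)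
    (hle : ∀ x, 0 < x → (g' x + (x - a) * g x) ^ 2 - 2 * g x ^ 2 ≤ Q' x) :
    ∫ x in Ioi 0, energyDensity a (fun x => (g x : ℂ)) x ≤ -(a * g 0 ^ 2 + Q 0) := by
  have hFd : ∀ x, HasDerivAt (fun x => (x - a) * g x ^ 2 - Q x)
      (1 * g x ^ 2 + (x - a) * (2 * g x * g' x) - Q' x) x := by
    intro x
    refine (((hasDerivAt_id x).sub_const a).mul ?_).sub (hQ x)
    simpa using (hd x).fun_pow 2
  have h := neg_le_integral_Ioi_of_hasDerivAt_of_le (s := 0)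
    (G := fun x => -energyDensity a (fun x => (g x : ℂ)) x)
    (K := fun x => a * ‖(g x : ℂ)‖ ^ 2 + K x)
    (fun x _ => (hFd x).continuousAt.continuousWithinAt) (fun x _ => hFd x) (fun x hx => ?_)
    (hg.integrable_energyDensity a).neg ((hg.2.2.1.const_mul a).add hK) (fun x hx => ?_)
  · rw [integral_neg] at h
    linarith
  · have hx' : 0 < x := hx
    simp only [energyDensity, (hd x).ofReal_comp.deriv, Complex.norm_real, Real.norm_eq_abs,
      sq_abs, abs_of_pos hx']
    nlinarith [hle x hx]
  · have hx' : 0 < x := hx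
    simp only [Complex.norm_real, Real.norm_eq_abs, sq_abs]
    nlinarith [hQK x hx, mul_nonneg hx'.le (sq_nonneg (g x))]

lemma exp_neg_sq_div_two_sq (x : ℝ) : Real.exp (-x ^ 2 / 2) ^ 2 = Real.exp (-x ^ 2) := by
  rw [← Real.exp_nat_mul]
  congr 1
  push_cast
  ring

lemma cosh_sub_sinh_sq (y : ℝ) : (Real.cosh y - Real.sinh y) ^ 2 = Real.exp (-2 * y) := by
  rw [Real.cosh_sub_sinh, ← Real.exp_nat_mul]
  congr 1
  push_cast
  ring

lemma hasDerivAt_exp_neg_sq (x : ℝ) :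
    HasDerivAt (fun x => Real.exp (-x ^ 2)) (-(2 * x) * Real.exp (-x ^ 2)) x := by
  convert ((hasDerivAt_pow 2 x).fun_neg).exp using 1
  push_cast
  ring

lemma integrable_exp_neg_sq : Integrable fun x : ℝ => Real.exp (-x ^ 2) := by
  simpa using integrable_exp_neg_mul_sq one_pos

/-- If the energy density is even, the form is determined by the half-line energy. -/
lemma B1_eq_two_mul_integral_Ioi {f : ℝ → ℂ} (hf : Admissible f) (a : ℝ)
    (hsymm : ∀ x, energyDensity a f (-x) = energyDensity a f x) :
    B1 (-2 * a) f = 2 * (∫ x in Ioi 0, energyDensity a f x) + 2 * a * ‖f 0‖ ^ 2 := by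
  rw [hf.B1_eq, hf.integral_energyDensity]
  simp_rw [Admissible.energyDensity_comp_neg, hsymm]
  ring

lemma B1_evenTrial_neg {a : ℝ} (ha : 0 < a) :
    B1 (-2 * a) (fun x => (evenTrial a x : ℂ)) < 0 := by
  have hadm := admissible_evenTrial ha
  have hQ : ∀ x, HasDerivAt
      (fun x => 2 * a * Real.exp (-x ^ 2) - a / 2 * (Real.exp (-x ^ 2) * Real.exp (-2 * (a * x))))
      (2 * a * (-(2 * x) * Real.exp (-x ^ 2)) -
        a / 2 * (-(2 * x) * Real.exp (-x ^ 2) * Real.exp (-2 * (a * x)) +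
          Real.exp (-x ^ 2) * (Real.exp (-2 * (a * x)) * (-2 * (a * 1))))) x := by
    intro x
    exact ((hasDerivAt_exp_neg_sq x).const_mul _).sub (((hasDerivAt_exp_neg_sq x).mul
      ((((hasDerivAt_id x).const_mul a).const_mul (-2)).exp)).const_mul _)
  have h := integral_Ioi_energyDensity_le (a := a) hadm (hasDerivAt_evenTrial a) hQ
    (integrable_exp_neg_sq.const_mul (2 * a))
    (fun x _ => sub_le_self _ (by positivity)) fun x hx => ?_
  · rw [B1_eq_two_mul_integral_Ioi hadm a fun x => ?_]
    · simp only [evenTrial, Complex.norm_real, Real.norm_eq_abs, sq_abs] at h ⊢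
      norm_num at h ⊢
      linarith
    · rw [← Admissible.energyDensity_comp_neg]
      simp [evenTrial]
  · have hax : 0 < a * x := mul_pos ha hx
    have hsinh := Real.self_le_sinh_iff.2 hax.le
    have hcosh : 2 * (a * x) ≤ Real.cosh (a * x) ^ 2 := by
      rw [Real.cosh_sq]
      nlinarith [sq_nonneg (Real.sinh (a * x) - 1)]
    have hsq : (Real.exp (-x ^ 2 / 2) * (a * Real.sinh (a * x) - x * Real.cosh (a * x)) +
        (x - a) * evenTrial a x) ^ 2 =
        a ^ 2 * (Real.exp (-x ^ 2) * Real.exp (-2 * (a * x))) := by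
      rw [evenTrial, ← exp_neg_sq_div_two_sq, ← cosh_sub_sinh_sq]
      ring
    have hg : evenTrial a x ^ 2 = Real.exp (-x ^ 2) * Real.cosh (a * x) ^ 2 := by
      rw [evenTrial, mul_pow, exp_neg_sq_div_two_sq]
    rw [hsq, hg]
    have := mul_le_mul_of_nonneg_left hcosh (Real.exp_pos (-x ^ 2)).le
    have : 0 < a * x * (Real.exp (-x ^ 2) * Real.exp (-2 * (a * x))) := by positivity
    linarith

lemma B1_oddTrial_neg {a : ℝ} (ha : 0 < a) :
    B1 (-2 * a) (fun x => (oddTrial a x : ℂ)) < 0 := by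
  have hadm := admissible_oddTrial ha
  have hQ : ∀ x, HasDerivAt
      (fun x => a ^ 2 * (x * Real.exp (-x ^ 2)) +
        a ^ 3 * Real.exp (-a ^ 2) / 2 * Real.exp (-x ^ 2) ^ 2)
      (a ^ 2 * (1 * Real.exp (-x ^ 2) + x * (-(2 * x) * Real.exp (-x ^ 2))) +
        a ^ 3 * Real.exp (-a ^ 2) / 2 *
          (2 * Real.exp (-x ^ 2) * (-(2 * x) * Real.exp (-x ^ 2)))) x := by
    intro x
    refine (((hasDerivAt_id x).mul (hasDerivAt_exp_neg_sq x)).const_mul _).add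
      (HasDerivAt.const_mul _ ?_)
    simpa using (hasDerivAt_exp_neg_sq x).fun_pow 2
  have hKi : Integrable fun x : ℝ => a ^ 2 * (x * Real.exp (-x ^ 2)) +
      a ^ 3 * Real.exp (-a ^ 2) / 2 * Real.exp (-x ^ 2) ^ 2 := by
    refine Integrable.add (.const_mul ?_ _) (.const_mul ?_ _)
    · simpa using integrable_mul_exp_neg_mul_sq one_pos
    · refine (integrable_exp_neg_mul_sq two_pos).congr (ae_of_all _ fun x => ?_)
      simp only [← Real.exp_nat_mul]
      congr 1
      push_cast
      ring
  have h := integral_Ioi_energyDensity_le (a := a) hadm (hasDerivAt_oddTrial a) hQ hKi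
    (fun x _ => le_rfl) fun x hx => ?_
  · rw [B1_eq_two_mul_integral_Ioi hadm a fun x => ?_]
    · simp only [oddTrial, Complex.norm_real, Real.norm_eq_abs, sq_abs] at h ⊢
      have : 0 < a ^ 3 * Real.exp (-a ^ 2) := by positivity
      norm_num at h ⊢
      linarith
    · rw [← Admissible.energyDensity_comp_neg]
      simp [energyDensity, oddTrial, deriv.fun_neg]
  · have hax : 0 < a * x := mul_pos ha hx
    have hsinh : (a * x) ^ 2 ≤ Real.sinh (a * x) ^ 2 :=
      pow_le_pow_left₀ hax.le (Real.self_le_sinh_iff.2 hax.le) 2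
    have hsq : (Real.exp (-x ^ 2 / 2) * (a * Real.cosh (a * x) - x * Real.sinh (a * x)) +
        (x - a) * oddTrial a x) ^ 2 =
        a ^ 2 * (Real.exp (-x ^ 2) * Real.exp (-2 * (a * x))) := by
      rw [oddTrial, ← exp_neg_sq_div_two_sq, ← cosh_sub_sinh_sq]
      ring
    have hg : oddTrial a x ^ 2 = Real.exp (-x ^ 2) * Real.sinh (a * x) ^ 2 := by
      rw [oddTrial, mul_pow, exp_neg_sq_div_two_sq]
    have hgauss : Real.exp (-a ^ 2) * Real.exp (-x ^ 2) ≤ Real.exp (-2 * (a * x)) := by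
      rw [← Real.exp_add]
      gcongr
      nlinarith [sq_nonneg (x - a)]
    have hexp : Real.exp (-2 * (a * x)) * (1 + 2 * (a * x)) ≤ 1 := by
      have h1 := Real.add_one_le_exp (2 * (a * x))
      have h2 : Real.exp (-2 * (a * x)) * Real.exp (2 * (a * x)) = 1 := by
        rw [← Real.exp_add, neg_mul, neg_add_cancel, Real.exp_zero]
      rw [← h2]
      gcongr
      linarith
    have hkey : Real.exp (-2 * (a * x)) +
        2 * (a * x) * (Real.exp (-a ^ 2) * Real.exp (-x ^ 2)) ≤ 1 := by
      nlinarith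
    rw [hsq, hg]
    have h1 := mul_le_mul_of_nonneg_left hsinh (Real.exp_pos (-x ^ 2)).le
    have h2 := mul_le_mul_of_nonneg_left hkey
      (by positivity : 0 ≤ a ^ 2 * Real.exp (-x ^ 2))
    linarith

/-- For `γ < 0`, the operator `L₁^γ` has exactly two negative eigenvalues, expressed via
its quadratic form: (a) the form is negative on a two-dimensional subspace of `W̃`; and
(b) it is not negative definite on any three-dimensional subspace. -/
theorem stmt14 (γ : ℝ) (hγ : γ < 0) :
    (∃ f₁ f₂ : ℝ → ℂ, Admissible f₁ ∧ Admissible f₂ ∧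
      LinearIndependent ℂ ![f₁, f₂] ∧
      ∀ c₁ c₂ : ℂ, ¬(c₁ = 0 ∧ c₂ = 0) → B1 γ (c₁ • f₁ + c₂ • f₂) < 0) ∧
    (∀ f₁ f₂ f₃ : ℝ → ℂ, Admissible f₁ → Admissible f₂ → Admissible f₃ →
      LinearIndependent ℂ ![f₁, f₂, f₃] →
      ∃ c₁ c₂ c₃ : ℂ, ¬(c₁ = 0 ∧ c₂ = 0 ∧ c₃ = 0) ∧
        0 ≤ B1 γ (c₁ • f₁ + c₂ • f₂ + c₃ • f₃)) := by
  obtain ⟨a, ha, rfl⟩ : ∃ a : ℝ, 0 < a ∧ γ = -2 * a := ⟨-γ / 2, by linarith, by ring⟩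
  constructor
  · have hp := admissible_evenTrial ha
    have hq := admissible_oddTrial ha
    have hneg : ∀ c₁ c₂ : ℂ, ¬(c₁ = 0 ∧ c₂ = 0) → B1 (-2 * a)
        (c₁ • (fun x => (evenTrial a x : ℂ)) + c₂ • fun x => (oddTrial a x : ℂ)) < 0 := by
      intro c₁ c₂ hc
      rw [(hp.const_smul c₁).B1_even_add_odd (hq.const_smul c₂) (fun x => by simp [evenTrial])
        (fun x => by simp [oddTrial]), hp.B1_const_smul, hq.B1_const_smul]
      have h₁ := B1_evenTrial_neg ha
      have h₂ := B1_oddTrial_neg ha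
      by_cases hc₁ : c₁ = 0
      · have : 0 < ‖c₂‖ ^ 2 := by
          have := norm_pos_iff.2 fun h => hc ⟨hc₁, h⟩
          positivity
        nlinarith [sq_nonneg ‖c₁‖]
      · have : 0 < ‖c₁‖ ^ 2 := by
          have := norm_pos_iff.2 hc₁
          positivity
        nlinarith [sq_nonneg ‖c₂‖]
    refine ⟨_, _, hp, hq, ?_, hneg⟩
    rw [LinearIndependent.pair_iff]
    intro c₁ c₂ h
    by_contra hc
    have := hneg c₁ c₂ hc
    rw [h] at this
    simp [B1] at this
  · intro f₁ f₂ f₃ h₁ h₂ h₃ _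
    have hker : (Matrix.mulVecLin !![f₁ a, f₂ a, f₃ a; f₁ (-a), f₂ (-a), f₃ (-a)]).ker ≠ ⊥ :=
      LinearMap.ker_ne_bot_of_finrank_lt (by simp)
    obtain ⟨c, hc, hc0⟩ := Submodule.exists_mem_ne_zero_of_ne_bot hker
    rw [LinearMap.mem_ker, Matrix.mulVecLin_apply] at hc
    refine ⟨c 0, c 1, c 2, fun h => hc0 ?_, ?_⟩
    · ext i
      fin_cases i <;> simp [h]
    · have e₁ := congrFun hc 0
      have e₂ := congrFun hc 1
      simp [Matrix.mulVec, dotProduct, Fin.sum_univ_three] at e₁ e₂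
      refine (((h₁.const_smul _).add (h₂.const_smul _)).add (h₃.const_smul _)).B1_nonneg ha ?_ ?_
      · simp only [Pi.add_apply, Pi.smul_apply, smul_eq_mul]
        linear_combination e₁
      · simp only [Pi.add_apply, Pi.smul_apply, smul_eq_mul]
        linear_combination e₂
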